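/- Let Γ be a finite connected non-complete graph of prime valency p that is 2-geodesic transitive but not 2-arc transitive. Then for every vertex v, the number of vertices at distance 2 from v equals p. -/

import Mathlib

open SimpleGraph

/-- `Γ` is arc transitive: its automorphism group is transitive on ordered pairs
of adjacent vertices. -/
def ArcTransitive {V : Type*} (Γ : SimpleGraph V) : Prop :=
  ∀ ⦃v u v' u' : V⦄, Γ.Adj v u → Γ.Adj v' u' →
    ∃ φ : Γ ≃g Γ, φ v = v' ∧ φ u = u'

/-- `(v,u,w)` is a 2-arc of `Γ`. -/
def Is2Arc {V : Type*} (Γ : SimpleGraph V) (v u w : V) : Prop :=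
  Γ.Adj v u ∧ Γ.Adj u w ∧ v ≠ w

/-- `(v,u,w)` is a 2-geodesic of `Γ`: a 2-arc with `v`, `w` non-adjacent. -/
def Is2Geodesic {V : Type*} (Γ : SimpleGraph V) (v u w : V) : Prop :=
  Γ.Adj v u ∧ Γ.Adj u w ∧ v ≠ w ∧ ¬ Γ.Adj v w

/-- `Γ` is 2-arc transitive: arc transitive and transitive on 2-arcs. -/
def TwoArcTransitive {V : Type*} (Γ : SimpleGraph V) : Prop :=
  ArcTransitive Γ ∧
  ∀ ⦃v u w v' u' w' : V⦄, Is2Arc Γ v u w → Is2Arc Γ v' u' w' →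
    ∃ φ : Γ ≃g Γ, φ v = v' ∧ φ u = u' ∧ φ w = w'

/-- `Γ` is 2-geodesic transitive: arc transitive and transitive on 2-geodesics. -/
def TwoGeodesicTransitive {V : Type*} (Γ : SimpleGraph V) : Prop :=
  ArcTransitive Γ ∧
  ∀ ⦃v u w v' u' w' : V⦄, Is2Geodesic Γ v u w → Is2Geodesic Γ v' u' w' →
    ∃ φ : Γ ≃g Γ, φ v = v' ∧ φ u = u' ∧ φ w = w'

open Polynomial in
theorem Finset.exists_sum_pow_ne_zero {K : Type*} [Field K] (U : Finset K) (h0 : (0 : K) ∉ U)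
    (hU : U.Nonempty) : ∃ r, 1 ≤ r ∧ r ≤ U.card ∧ ∑ u ∈ U, u ^ r ≠ 0 := by
  classical
  by_contra! h
  obtain ⟨a, ha⟩ := hU
  let g : K[X] := X * ∏ u ∈ U.erase a, (X - C u)
  have hdeg : g.natDegree ≤ U.card := by
    refine natDegree_mul_le.trans ?_
    rw [natDegree_X, natDegree_finsetProd_X_sub_C_eq_card, Finset.card_erase_of_mem ha]
    have := Finset.card_pos.mpr ⟨a, ha⟩
    omega
  have hsum : ∑ u ∈ U, g.eval u = 0 := by
    simp_rw [eval_eq_sum_range' (Nat.lt_succ_of_le hdeg)]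
    rw [Finset.sum_comm]
    refine Finset.sum_eq_zero fun k hk => ?_
    rw [← Finset.mul_sum]
    rcases Nat.eq_zero_or_pos k with rfl | hk0
    · simp [g]
    · rw [h k hk0 (Nat.lt_succ_iff.mp (Finset.mem_range.mp hk)), mul_zero]
  rw [Finset.sum_eq_single_of_mem a ha] at hsum
  · simp only [g, eval_mul, eval_X, eval_prod, eval_sub, eval_C, mul_eq_zero,
      Finset.prod_eq_zero_iff, sub_eq_zero] at hsum
    rcases hsum with rfl | ⟨u, hu, rfl⟩
    · exact h0 ha
    · simp at hu
  · intro u hu hne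
    simp only [g, eval_mul, eval_prod]
    rw [Finset.prod_eq_zero (Finset.mem_erase.mpr ⟨hne, hu⟩) (by simp), mul_zero]

theorem ZMod.exists_least_sum_pow_ne_zero {p : ℕ} [Fact p.Prime] (U : Finset (ZMod p))
    (h0 : (0 : ZMod p) ∉ U) (hU : U.Nonempty) (hU' : ∃ x ≠ 0, x ∉ U) :
    ∃ r, 1 ≤ r ∧ 2 * r ≤ p - 1 ∧ ∑ u ∈ U, u ^ r ≠ 0 ∧
      ∀ k, 1 ≤ k → k < r → ∑ u ∈ U, u ^ k = 0 := by
  suffices h : ∃ r, 1 ≤ r ∧ 2 * r ≤ p - 1 ∧ ∑ u ∈ U, u ^ r ≠ 0 by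
    classical
    have h' : ∃ r, 1 ≤ r ∧ ∑ u ∈ U, u ^ r ≠ 0 := by
      obtain ⟨r, h1, -, h2⟩ := h
      exact ⟨r, h1, h2⟩
    obtain ⟨r, h1, h2, h3⟩ := h
    refine ⟨Nat.find h', (Nat.find_spec h').1, ?_, (Nat.find_spec h').2, fun k hk hlt => ?_⟩
    · have := Nat.find_min' h' ⟨h1, h3⟩
      omega
    · by_contra hne
      exact Nat.find_min h' hlt ⟨hk, hne⟩
  have hcard : (insert 0 U).card + (insert 0 U)ᶜ.card = p := by
    rw [Finset.card_add_card_compl, ZMod.card]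
  rw [Finset.card_insert_of_notMem h0] at hcard
  have hUpos := hU.card_pos
  rcases Nat.lt_or_ge (p - 1) (2 * U.card) with hlt | hle
  · obtain ⟨r, h1, h2, h3⟩ := Finset.exists_sum_pow_ne_zero (insert 0 U)ᶜ (by simp)
      (by obtain ⟨x, hx, hxU⟩ := hU'; exact ⟨x, by simp [hx, hxU]⟩)
    refine ⟨r, h1, by omega, fun h => h3 ?_⟩
    have hs := FiniteField.sum_pow_lt_card_sub_one (ZMod p) r (by rw [ZMod.card]; omega)
    rw [← Finset.sum_add_sum_compl (insert 0 U), Finset.sum_insert h0, h,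
      zero_pow (by omega), zero_add, zero_add] at hs
    exact hs
  · obtain ⟨r, h1, h2, h3⟩ := Finset.exists_sum_pow_ne_zero U h0 hU
    exact ⟨r, h1, by omega, h3⟩

open Polynomial in
/-- Müller's lemma: an injective self-map of `ZMod p` preserving a nontrivial difference set
is affine. -/
theorem ZMod.exists_affine_of_preserves_differences {p : ℕ} [Fact p.Prime] (U : Finset (ZMod p))
    (h0 : (0 : ZMod p) ∉ U) (hU : U.Nonempty) (hU' : ∃ x ≠ 0, x ∉ U)
    (π : ZMod p → ZMod p) (hinj : Function.Injective π)
    (hπ : ∀ x y, x - y ∈ U → π x - π y ∈ U) :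
    ∃ a b, ∀ x, π x = a * x + b := by
  classical
  obtain ⟨r, hr1, hr2, hr, hmin⟩ := ZMod.exists_least_sum_pow_ne_zero U h0 hU hU'
  have hp := (Fact.out : p.Prime).two_le
  let f : (ZMod p)[X] := Lagrange.interpolate Finset.univ id π
  have hfdeg : f.natDegree < p := by
    have h := Lagrange.degree_interpolate_lt (s := Finset.univ) (v := id) π
      (Function.injective_id.injOn)
    rw [Finset.card_univ, ZMod.card] at h
    by_cases hf : f = 0
    · simp [hf]; omega
    · exact (natDegree_lt_iff_degree_lt hf).mpr h
  have hfe : ∀ x, f.eval x = π x := fun x =>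
    Lagrange.eval_interpolate_at_node (s := Finset.univ) (v := id) π
      (Function.injective_id.injOn) (Finset.mem_univ x)
  by_cases hn : f.natDegree ≤ 1
  · refine ⟨f.coeff 1, f.coeff 0, fun x => ?_⟩
    rw [← hfe, eval_eq_sum_range' (Nat.lt_succ_of_le hn)]
    simp [Finset.sum_range_succ, add_comm]
  exfalso
  push Not at hn
  set n := f.natDegree with hndef
  let w := (p - 1) / n
  have hw1 : 1 ≤ w := by
    rw [Nat.le_div_iff_mul_le (by omega)]; omega
  have hmlt : n * w < p := by
    have := Nat.mul_div_le (p - 1) n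
    change n * w ≤ _ at this
    omega
  have hrm : r ≤ n * w := by
    have h1 := Nat.lt_mul_div_succ (p - 1) (b := n) (by omega)
    change _ < n * (w + 1) at h1
    have h2 : n * 1 ≤ n * w := Nat.mul_le_mul_left _ hw1
    rw [mul_add] at h1
    omega
  have hdegw : (f ^ w).natDegree = n * w := by rw [natDegree_pow, mul_comm]
  have hpoly : ∑ u ∈ U, taylor u (f ^ w) = ∑ u ∈ U, (f + C u) ^ w := by
    rw [← sub_eq_zero]
    refine eq_zero_of_natDegree_lt_card_of_eval_eq_zero _ (f := (id : ZMod p → ZMod p))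
      Function.injective_id (fun x => ?_) ?_
    · rw [eval_sub, sub_eq_zero, eval_finsetSum, eval_finsetSum]
      simp only [taylor_eval, eval_pow, eval_add, eval_C, hfe, id]
      have hinj' : Set.InjOn (fun u => π (u + x) - π x) U := fun a _ b _ h =>
        add_right_cancel (hinj (sub_left_injective h))
      have himg : U.image (fun u => π (u + x) - π x) = U := by
        refine Finset.eq_of_subset_of_card_le ?_ (Finset.card_image_of_injOn hinj').ge
        intro y hy
        obtain ⟨u, hu, rfl⟩ := Finset.mem_image.mp hy
        exact hπ _ _ (by simpa using hu)
      conv_rhs => rw [← himg, Finset.sum_image hinj']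
      simp [add_comm]
    · rw [ZMod.card]
      refine lt_of_le_of_lt (natDegree_sub_le _ _) (lt_of_le_of_lt (b := n * w) ?_ hmlt)
      refine max_le (natDegree_sum_le_of_forall_le _ _ fun u _ => ?_)
        (natDegree_sum_le_of_forall_le _ _ fun u _ => ?_)
      · rw [natDegree_taylor, hdegw]
      · rw [natDegree_pow, natDegree_add_C, mul_comm]
  set g := f ^ w with hg
  set m := n * w with hm
  have hL : (∑ u ∈ U, taylor u g).coeff (m - r) =
      U.card * g.coeff (m - r) + (m.choose (m - r)) * g.leadingCoeff * ∑ u ∈ U, u ^ r := by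
    simp_rw [finsetSum_coeff, taylor_coeff]
    have hterm : ∀ u, (hasseDeriv (m - r) g).eval u =
        ∑ i ∈ Finset.range (r + 1), (((i + (m - r)).choose (m - r) : ℕ) : ZMod p) *
          g.coeff (i + (m - r)) * u ^ i := by
      intro u
      rw [eval_eq_sum_range' (n := r + 1)]
      · simp_rw [hasseDeriv_coeff]
      · have := natDegree_hasseDeriv_le g (m - r)
        omega
    simp_rw [hterm]
    rw [Finset.sum_comm]
    simp_rw [← Finset.mul_sum]
    rw [Finset.sum_range_succ, Finset.sum_eq_single_of_mem 0 (by simp; omega)]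
    · rw [Nat.add_sub_cancel' hrm, leadingCoeff, hdegw]
      simp [mul_comm]
    · intro i hi hi0
      rw [hmin i (by omega) (Finset.mem_range.mp hi), mul_zero]
  have hR : (∑ u ∈ U, (f + C u) ^ w).coeff (m - r) = U.card * g.coeff (m - r) := by
    have hterm : ∀ u : ZMod p, ((f + C u) ^ w).coeff (m - r) =
        ∑ k ∈ Finset.range (w + 1), (f ^ (w - k)).coeff (m - r) * (w.choose k : ZMod p) * u ^ k := by
      intro u
      rw [add_comm f, add_pow, finsetSum_coeff]
      refine Finset.sum_congr rfl fun k _ => ?_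
      rw [← C_pow, ← C_eq_natCast, mul_assoc, coeff_C_mul, coeff_mul_C]
      ring
    simp_rw [finsetSum_coeff, hterm]
    rw [Finset.sum_comm]
    simp_rw [← Finset.mul_sum]
    rw [Finset.sum_eq_single_of_mem 0 (by simp)]
    · simp [hg, mul_comm]
    · intro k hk hk0
      rcases Nat.lt_or_ge k r with hkr | hkr
      · rw [hmin k (by omega) hkr, mul_zero]
      · rw [coeff_eq_zero_of_natDegree_lt, zero_mul, zero_mul]
        have hkw : k ≤ w := Nat.lt_succ_iff.mp (Finset.mem_range.mp hk)
        rw [natDegree_pow, mul_comm, ← hndef, Nat.mul_sub]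
        have h1 : 2 * k ≤ n * k := Nat.mul_le_mul_right _ hn
        have h2 : n * k ≤ n * w := Nat.mul_le_mul_left _ hkw
        omega
  rw [hpoly, hR] at hL
  have hz := left_eq_add.mp hL
  have hf0 : f ≠ 0 := by
    rintro h
    rw [hndef, h] at hn
    simp at hn
  have hg0 : g.leadingCoeff ≠ 0 := leadingCoeff_ne_zero.mpr (pow_ne_zero _ hf0)
  have hchoose : ((m.choose (m - r) : ℕ) : ZMod p) ≠ 0 := by
    rw [Ne, ZMod.natCast_eq_zero_iff]
    intro hdvd
    have hfact : p ∣ m.factorial := by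
      rw [← Nat.choose_mul_factorial_mul_factorial (Nat.sub_le m r)]
      exact (hdvd.mul_right _).mul_right _
    have := (Nat.Prime.dvd_factorial Fact.out).mp hfact
    omega
  exact mul_ne_zero (mul_ne_zero hchoose hg0) hr hz

theorem ZMod.card_eq_of_dvd_card_of_lt {p : ℕ} [Fact p.Prime] (U D : Finset (ZMod p))
    (hU0 : (0 : ZMod p) ∉ U) (hU : U.Nonempty) (hD : D.Nonempty)
    (hmemD : ∀ x, x ∈ D ↔ x ≠ 0 ∧ x ∉ U) (hneg : ∀ x ∈ U, -x ∈ U)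
    (hmul : ∀ x ∈ U, ∀ y ∈ U, ∃ a, a * x = y ∧ ∀ z ∈ U, a * z ∈ U)
    (c : ℕ) (hc : c ∣ U.card) (hlt : ∀ w ∈ U, (D.filter (fun x => x - w ∈ D)).card < c) :
    c = U.card := by
  classical
  obtain ⟨u₀, hu₀⟩ := hU
  have hne : ∀ x ∈ U, x ≠ 0 := fun x hx h => hU0 (h ▸ hx)
  have hu₀ne := hne u₀ hu₀
  have hcle : c ≤ U.card := Nat.le_of_dvd (Finset.card_pos.mpr ⟨u₀, hu₀⟩) hc
  let H : Subgroup (ZMod p)ˣ :=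
    { carrier := {a | ∀ z, (a : ZMod p) * z ∈ U ↔ z ∈ U}
      one_mem' := by simp
      mul_mem' := by
        intro a b ha hb z
        rw [Units.val_mul, mul_assoc, ha, hb]
      inv_mem' := by
        intro a ha z
        rw [← ha, Units.mul_inv_cancel_left] }
  have hH : ∀ a : (ZMod p)ˣ, a ∈ H ↔ (a : ZMod p) * u₀ ∈ U := by
    intro a
    refine ⟨fun h => (h u₀).mpr hu₀, fun h => ?_⟩
    obtain ⟨b, hb, hbU⟩ := hmul u₀ hu₀ _ h
    obtain rfl : b = a := mul_right_cancel₀ hu₀ne hb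
    have himg : U.image (fun z => (a : ZMod p) * z) = U := by
      refine Finset.eq_of_subset_of_card_le ?_
        (Finset.card_image_of_injective _ (mul_right_injective₀ a.ne_zero)).ge
      intro y hy
      obtain ⟨z, hz, rfl⟩ := Finset.mem_image.mp hy
      exact hbU z hz
    refine fun z => ⟨fun hz => ?_, hbU z⟩
    rw [← himg] at hz
    obtain ⟨y, hy, hyz⟩ := Finset.mem_image.mp hz
    exact mul_right_injective₀ a.ne_zero hyz ▸ hy
  have hHcard : Nat.card H = U.card := by
    rw [← Fintype.card_coe, ← Nat.card_eq_fintype_card]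
    refine Nat.card_congr (Equiv.ofBijective
      (fun a : H => (⟨((a : (ZMod p)ˣ) : ZMod p) * u₀, (hH a).mp a.2⟩ : U)) ⟨?_, ?_⟩)
    · intro a b hab
      exact Subtype.ext (Units.ext (mul_right_cancel₀ hu₀ne (congrArg Subtype.val hab)))
    · rintro ⟨y, hy⟩
      have hy' : y * u₀⁻¹ * u₀ = y := inv_mul_cancel_right₀ hu₀ne y
      refine ⟨⟨Units.mk0 (y * u₀⁻¹) (mul_ne_zero (hne y hy) (inv_ne_zero hu₀ne)),
        (hH _).mpr ?_⟩, Subtype.ext hy'⟩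
      rw [Units.val_mk0, hy']
      exact hy
  have hindex : U.card * H.index = p - 1 := by
    rw [← hHcard, Subgroup.card_mul_index, Nat.card_eq_fintype_card, ZMod.card_units]
  have hDU : D = (insert 0 U)ᶜ := by
    ext x
    simp [hmemD]
  have hcard : U.card + 1 + D.card = p := by
    rw [hDU, ← Finset.card_insert_of_notMem hU0, Finset.card_add_card_compl, ZMod.card]
  have hDpos := hD.card_pos
  have hlow : p ≤ (D.filter (fun x => x - u₀ ∈ D)).card + (U.card + U.card) := by
    have hcov : (Finset.univ : Finset (ZMod p)) ⊆
        D.filter (fun x => x - u₀ ∈ D) ∪ (U ∪ U.image (fun x => x + u₀)) := by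
      intro x _
      have him : ∀ y, y ∈ U → y = x - u₀ → x ∈ U.image (fun x => x + u₀) := by
        rintro y hy rfl
        exact Finset.mem_image.mpr ⟨_, hy, sub_add_cancel _ _⟩
      simp only [Finset.mem_union, Finset.mem_filter, hmemD]
      by_cases hx : x ∈ U
      · exact Or.inr (Or.inl hx)
      by_cases hx' : x - u₀ ∈ U
      · exact Or.inr (Or.inr (him _ hx' rfl))
      by_cases hx0 : x = 0
      · exact Or.inr (Or.inr (him _ (hneg _ hu₀) (by simp [hx0])))
      · refine Or.inl ⟨⟨hx0, hx⟩, fun h => hx ?_, hx'⟩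
        rwa [sub_eq_zero.mp h]
    have h1 := Finset.card_le_card hcov
    rw [Finset.card_univ, ZMod.card] at h1
    have h2 := Finset.card_union_le (D.filter (fun x => x - u₀ ∈ D)) (U ∪ U.image (fun x => x + u₀))
    have h3 := Finset.card_union_le U (U.image (fun x => x + u₀))
    have h4 : (U.image (fun x => x + u₀)).card ≤ U.card := Finset.card_image_le
    omega
  have hindex2 : H.index = 2 := by
    have h1 := hlt u₀ hu₀
    have h3 : H.index < 3 := by
      by_contra! h
      have := Nat.mul_le_mul_left U.card h
      omega
    interval_cases h : H.index <;> omega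
  obtain ⟨d, hd⟩ := hD
  have hd' := (hmemD d).mp hd
  let t : (ZMod p)ˣ := Units.mk0 (d * u₀⁻¹) (mul_ne_zero hd'.1 (inv_ne_zero hu₀ne))
  have ht : t ∉ H := by
    rw [hH]
    change d * u₀⁻¹ * u₀ ∉ U
    rw [inv_mul_cancel_right₀ hu₀ne]
    exact hd'.2
  have htU : ∀ x, x ≠ 0 → ((t : ZMod p) * x ∈ U ↔ x ∉ U) := by
    intro x hx
    let y : (ZMod p)ˣ := Units.mk0 (x * u₀⁻¹) (mul_ne_zero hx (inv_ne_zero hu₀ne))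
    have hy : (y : ZMod p) * u₀ = x := inv_mul_cancel_right₀ hu₀ne x
    have h := Subgroup.mul_mem_iff_of_index_two hindex2 (a := t) (b := y)
    rw [hH, hH y, Units.val_mul, mul_assoc, hy] at h
    rw [h]
    tauto
  have htD : ∀ x, x ≠ 0 → ((t : ZMod p) * x ∈ D ↔ x ∈ U) := by
    intro x hx
    rw [hmemD, htU x hx]
    have := mul_ne_zero t.ne_zero hx
    tauto
  have hnegD : ∀ x ∈ D, -x ∈ D := by
    intro x hx
    rw [hmemD] at hx ⊢
    refine ⟨neg_ne_zero.mpr hx.1, fun h => hx.2 ?_⟩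
    simpa using hneg _ h
  -- Multiplication by `-t` swaps the two kinds of pairs in `U × D`.
  have hswap : ((U ×ˢ D).filter (fun q => q.2 - q.1 ∉ D)).card ≤
      ((U ×ˢ D).filter (fun q => q.2 - q.1 ∈ D)).card := by
    refine Finset.card_le_card_of_injOn (fun q => ((t : ZMod p) * q.2, (t : ZMod p) * q.1)) ?_ ?_
    · rintro ⟨w, x⟩ hq
      simp only [Finset.coe_filter, Finset.mem_product, Set.mem_ofPred_eq] at hq ⊢
      obtain ⟨⟨hw, hx⟩, hxw⟩ := hq
      have hx' := (hmemD x).mp hx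
      have hsub : x - w ≠ 0 := fun h => hx'.2 (sub_eq_zero.mp h ▸ hw)
      refine ⟨⟨(htU x hx'.1).mpr hx'.2, (htD w (hne w hw)).mpr hw⟩, ?_⟩
      rw [← mul_sub, ← neg_sub, mul_neg]
      refine hnegD _ ((htD _ hsub).mpr ?_)
      by_contra h
      exact hxw ((hmemD _).mpr ⟨hsub, h⟩)
    · rintro ⟨w, x⟩ - ⟨w', x'⟩ - h
      simpa [and_comm] using h
  have htot := Finset.card_filter_add_card_filter_not (s := U ×ˢ D) (fun q => q.2 - q.1 ∈ D)
  rw [Finset.card_product] at htot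
  have hsum : ((U ×ˢ D).filter (fun q => q.2 - q.1 ∈ D)).card =
      ∑ w ∈ U, (D.filter (fun x => x - w ∈ D)).card := by
    simp_rw [Finset.card_filter, Finset.sum_product]
  have hsumle : ∑ w ∈ U, (D.filter (fun x => x - w ∈ D)).card ≤ U.card * (c - 1) := by
    rw [← smul_eq_mul]
    exact Finset.sum_le_card_nsmul _ _ _ fun w hw => Nat.le_sub_one_of_lt (hlt w hw)
  have hkey : U.card * D.card ≤ U.card * (2 * (c - 1)) := by
    rw [Nat.mul_left_comm]
    omega
  have hDc := Nat.le_of_mul_le_mul_left hkey (Finset.card_pos.mpr ⟨u₀, hu₀⟩)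
  rw [hindex2] at hindex
  obtain ⟨s, hs⟩ := hc
  have hs1 : s ≠ 0 := by
    rintro rfl
    omega
  have hs2 : s < 2 := by
    by_contra! h
    have := Nat.mul_le_mul_left c h
    omega
  obtain rfl : s = 1 := by omega
  omega

theorem Subgroup.exists_equiv_zmod_of_transitive {X : Type*} [Finite X] {p : ℕ} [Fact p.Prime]
    (hX : Nat.card X = p) (G : Subgroup (Equiv.Perm X)) (hG : ∀ x y, ∃ σ ∈ G, σ x = y) (a : X) :
    ∃ σ ∈ G, ∃ e : ZMod p ≃ X, e 0 = a ∧ ∀ i, σ (e i) = e (i + 1) := by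
  classical
  have := Fintype.ofFinite X
  have hX' : Fintype.card X = p := by rw [← Nat.card_eq_fintype_card, hX]
  have hp : p.Prime := Fact.out
  have htrans : MulAction.IsPretransitive G X := ⟨fun x y => by
    obtain ⟨σ, hσ, h⟩ := hG x y
    exact ⟨⟨σ, hσ⟩, h⟩⟩
  have hdvd : p ∣ Nat.card G := by
    rw [← hX, ← MulAction.index_stabilizer_of_transitive G a]
    exact Subgroup.index_dvd_card _
  obtain ⟨⟨σ, hσ⟩, hord⟩ := exists_prime_orderOf_dvd_card' p hdvd
  rw [Subgroup.orderOf_mk] at hord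
  have hcyc : σ.IsCycle := Equiv.Perm.isCycle_of_prime_order'' (hX' ▸ hp) (hord.trans hX'.symm)
  have hsupp : σ.support = Finset.univ := by
    rw [← Finset.card_eq_iff_eq_univ, ← hcyc.orderOf, hord, hX']
  have hmem : ∀ x, σ x ≠ x := fun x => Equiv.Perm.mem_support.mp (hsupp ▸ Finset.mem_univ x)
  let f : ZMod p → X := fun i => (σ ^ i.val) a
  have hf : ∀ n : ℕ, f n = (σ ^ n) a := fun n => by
    simp only [f, ZMod.val_natCast]
    rw [← hord, pow_mod_orderOf]
  have hsurj : Function.Surjective f := fun y => by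
    obtain ⟨n, hn⟩ := hcyc.exists_pow_eq (hmem a) (hmem y)
    exact ⟨n, (hf n).trans hn⟩
  have hbij : Function.Bijective f :=
    (Fintype.bijective_iff_surjective_and_card f).mpr ⟨hsurj, by rw [ZMod.card, hX']⟩
  refine ⟨σ, hσ, Equiv.ofBijective f hbij, ?_, fun i => ?_⟩
  · simpa using hf 0
  · obtain ⟨n, rfl⟩ := ZMod.natCast_zmod_surjective i
    have h := hf (n + 1)
    rw [Nat.cast_add, Nat.cast_one] at h
    simp only [Equiv.ofBijective_apply, h, hf, pow_succ', Equiv.Perm.mul_apply]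

/-- The permutations of the neighbourhood of `u` induced by automorphisms. -/
def SimpleGraph.localGroup {V : Type*} (Γ : SimpleGraph V) (u : V) :
    Subgroup (Equiv.Perm (Γ.neighborSet u)) where
  carrier := {σ | ∃ φ : Γ ≃g Γ, ∀ x : Γ.neighborSet u, φ x = σ x}
  one_mem' := ⟨RelIso.refl _, fun _ => rfl⟩
  mul_mem' := by
    rintro σ τ ⟨φ, hφ⟩ ⟨ψ, hψ⟩
    exact ⟨ψ.trans φ, fun x => by simp [hφ, hψ]⟩
  inv_mem' := by
    rintro σ ⟨φ, hφ⟩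
    refine ⟨φ.symm, fun x => ?_⟩
    obtain ⟨y, rfl⟩ := σ.surjective x
    rw [← hφ, RelIso.symm_apply_apply, ← Equiv.Perm.mul_apply, inv_mul_cancel,
      Equiv.Perm.one_apply]

theorem SimpleGraph.exists_perm_neighborSet {V : Type*} {Γ : SimpleGraph V} {u : V}
    (φ : Γ ≃g Γ) (hφ : φ u = u) :
    ∃ σ : Equiv.Perm (Γ.neighborSet u), ∀ x : Γ.neighborSet u, φ x = σ x := by
  refine ⟨φ.toEquiv.subtypeEquiv fun x => ?_, fun _ => rfl⟩
  change Γ.Adj u x ↔ Γ.Adj u (φ x)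
  rw [← φ.map_adj_iff, hφ]

theorem ArcTransitive.exists_cyclic_coordinates {V : Type*} [Finite V] {Γ : SimpleGraph V}
    (hΓ : ArcTransitive Γ) {p : ℕ} [Fact p.Prime] {u v : V}
    (hu : Nat.card (Γ.neighborSet u) = p) (huv : Γ.Adj u v) :
    ∃ e : ZMod p ≃ Γ.neighborSet u, (e 0 : V) = v ∧
      ∀ x y, Γ.Adj (e x) (e y) ↔ Γ.Adj v (e (y - x)) := by
  have htrans : ∀ x y, ∃ σ ∈ Γ.localGroup u, σ x = y := by
    rintro ⟨x, hx⟩ ⟨y, hy⟩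
    obtain ⟨φ, hφu, hφx⟩ := hΓ hx hy
    obtain ⟨σ, hσ⟩ := SimpleGraph.exists_perm_neighborSet φ hφu
    exact ⟨σ, ⟨φ, hσ⟩, Subtype.ext ((hσ _).symm.trans hφx)⟩
  obtain ⟨σ, ⟨φ, hφ⟩, e, he0, he⟩ := Subgroup.exists_equiv_zmod_of_transitive hu
    (Γ.localGroup u) htrans ⟨v, huv⟩
  have hstep : ∀ x y, Γ.Adj (e x) (e y) ↔ Γ.Adj (e (x + 1)) (e (y + 1)) := by
    intro x y
    rw [← he, ← he, ← hφ, ← hφ, φ.map_adj_iff]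
  have hshift : ∀ (n : ℕ) x y, Γ.Adj (e x) (e y) ↔ Γ.Adj (e (x + n)) (e (y + n)) := by
    intro n
    induction n with
    | zero => simp
    | succ n ih =>
      intro x y
      rw [ih, hstep]
      push_cast
      simp only [add_assoc]
  refine ⟨e, by rw [he0], fun x y => ?_⟩
  obtain ⟨n, hn⟩ := ZMod.natCast_zmod_surjective (-x)
  rw [hshift n, hn, add_neg_cancel, he0, sub_eq_add_neg]

theorem SimpleGraph.dist_eq_two_iff {V : Type*} {Γ : SimpleGraph V} {x y : V} :
    Γ.dist x y = 2 ↔ x ≠ y ∧ ¬ Γ.Adj x y ∧ ∃ z, Γ.Adj x z ∧ Γ.Adj z y := by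
  rw [SimpleGraph.dist, ENat.toNat_eq_iff (by norm_num), Nat.cast_ofNat,
    SimpleGraph.edist_eq_two_iff]
  simp only [Set.Nonempty, SimpleGraph.mem_commonNeighbors, Γ.adj_comm y]

theorem SimpleGraph.Connected.exists_is2Geodesic {V : Type*} {Γ : SimpleGraph V}
    (hconn : Γ.Connected) (hnc : Γ ≠ ⊤) : ∃ a b c, Is2Geodesic Γ a b c := by
  obtain ⟨x, y, hxy, hadj⟩ := SimpleGraph.ne_top_iff_exists_not_adj.mp hnc
  obtain ⟨q, hq⟩ := hconn.exists_walk_length_eq_dist x y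
  have hlt : 1 < Γ.dist x y := by
    have h0 := hconn.pos_dist_of_ne hxy
    have h1 : Γ.dist x y ≠ 1 := fun h => hadj (SimpleGraph.dist_eq_one_iff_adj.mp h)
    omega
  obtain ⟨a, b, c, hab, hbc, hac, hne⟩ := SimpleGraph.Walk.exists_adj_adj_not_adj_ne hq hlt
  exact ⟨a, b, c, hab, hbc, hne, hac⟩

theorem TwoGeodesicTransitive.exists_triangle {V : Type*} {Γ : SimpleGraph V}
    (h : TwoGeodesicTransitive Γ) (h' : ¬ TwoArcTransitive Γ) :
    ∃ a b c, Γ.Adj a b ∧ Γ.Adj b c ∧ Γ.Adj a c := by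
  by_contra! hno
  refine h' ⟨h.1, fun v u w v' u' w' hv hv' => h.2 ?_ ?_⟩
  · exact ⟨hv.1, hv.2.1, hv.2.2, hno _ _ _ hv.1 hv.2.1⟩
  · exact ⟨hv'.1, hv'.2.1, hv'.2.2, hno _ _ _ hv'.1 hv'.2.1⟩

theorem SimpleGraph.Iso.dist_eq_two_iff {V : Type*} {Γ : SimpleGraph V} (φ : Γ ≃g Γ) (x y : V) :
    Γ.dist (φ x) (φ y) = 2 ↔ Γ.dist x y = 2 := by
  rw [SimpleGraph.dist_eq_two_iff, SimpleGraph.dist_eq_two_iff, φ.map_adj_iff,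
    φ.injective.ne_iff, φ.surjective.exists]
  simp only [φ.map_adj_iff]

/-- Counting the edges between the first two spheres around `v`. -/
theorem TwoGeodesicTransitive.card_mul_eq {V : Type*} [Fintype V] {Γ : SimpleGraph V}
    (h : TwoGeodesicTransitive Γ) {v u w : V} (hg : Is2Geodesic Γ v u w) :
    Nat.card (Γ.neighborSet v) * Nat.card {y | Γ.dist v y = 2 ∧ Γ.Adj u y} =
      Nat.card {y | Γ.dist v y = 2} * Nat.card {x | Γ.Adj v x ∧ Γ.Adj x w} := by
  classical
  have key := Finset.card_mul_eq_card_mul (s := Finset.univ.filter (fun x => Γ.Adj v x))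
    (t := Finset.univ.filter (fun y => Γ.dist v y = 2)) Γ.Adj
    (m := (Finset.univ.filter (fun y => Γ.dist v y = 2 ∧ Γ.Adj u y)).card)
    (n := (Finset.univ.filter (fun x => Γ.Adj v x ∧ Γ.Adj x w)).card) ?_ ?_
  · simpa [Nat.card_eq_fintype_card, Fintype.card_subtype, SimpleGraph.neighborSet] using key
  · intro x hx
    obtain ⟨φ, hφv, hφu⟩ := h.1 (Finset.mem_filter.mp hx).2 hg.1
    rw [Finset.bipartiteAbove, Finset.filter_filter]
    refine Finset.card_equiv φ.toEquiv fun y => ?_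
    change _ ↔ φ y ∈ _
    simp only [Finset.mem_filter, Finset.mem_univ, true_and]
    rw [← hφu, φ.map_adj_iff, ← φ.dist_eq_two_iff v y, hφv]
  · intro y hy
    obtain ⟨hne, hadj, z, hz1, hz2⟩ := SimpleGraph.dist_eq_two_iff.mp (Finset.mem_filter.mp hy).2
    obtain ⟨φ, hφv, -, hφw⟩ := h.2 ⟨hz1, hz2, hne, hadj⟩ hg
    rw [Finset.bipartiteBelow, Finset.filter_filter]
    refine Finset.card_equiv φ.toEquiv fun x => ?_
    change _ ↔ φ x ∈ _
    simp only [Finset.mem_filter, Finset.mem_univ, true_and]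
    rw [← hφw, φ.map_adj_iff, ← φ.map_adj_iff (v := v), hφv]

theorem stmt8 {V : Type*} [Fintype V] (Γ : SimpleGraph V) (p : ℕ)
    (hp : p.Prime)
    (hreg : ∀ v : V, Nat.card (Γ.neighborSet v) = p)
    (hconn : Γ.Connected)
    (hnc : Γ ≠ ⊤)
    (h2gt : TwoGeodesicTransitive Γ)
    (h2at : ¬ TwoArcTransitive Γ) :
    ∀ v : V, Nat.card {x : V | Γ.dist v x = 2} = p := by
  classical
  intro v
  have : Fact p.Prime := ⟨hp⟩
  obtain ⟨⟨u, hvu⟩⟩ : Nonempty (Γ.neighborSet v) :=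
    (Nat.card_pos_iff.mp (by rw [hreg]; exact hp.pos)).1
  change Γ.Adj v u at hvu
  obtain ⟨w, hg⟩ : ∃ w, Is2Geodesic Γ v u w := by
    obtain ⟨a, b, c, hab, hbc, hne, hac⟩ := hconn.exists_is2Geodesic hnc
    obtain ⟨φ, rfl, rfl⟩ := h2gt.1 hab hvu
    exact ⟨φ c, hvu, φ.map_adj_iff.mpr hbc, φ.injective.ne hne, fun h => hac (φ.map_adj_iff.mp h)⟩
  obtain ⟨t, hut, hvt⟩ : ∃ t, Γ.Adj u t ∧ Γ.Adj v t := by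
    obtain ⟨a, b, c, hab, hbc, hac⟩ := h2gt.exists_triangle h2at
    obtain ⟨φ, rfl, rfl⟩ := h2gt.1 hab hvu
    exact ⟨φ c, φ.map_adj_iff.mpr hbc, φ.map_adj_iff.mpr hac⟩
  obtain ⟨e, he0, he⟩ := h2gt.1.exists_cyclic_coordinates (hreg u) hvu.symm
  have hue : ∀ x, Γ.Adj u (e x) := fun x => (e x).2
  have hex : ∀ y, Γ.Adj u y → ∃ x, (e x : V) = y := fun y hy =>
    ⟨e.symm ⟨y, hy⟩, by rw [Equiv.apply_symm_apply]⟩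
  have heinj : ∀ x y, (e x : V) = e y ↔ x = y := fun x y => by
    rw [Subtype.coe_inj, e.apply_eq_iff_eq]
  let U : Finset (ZMod p) := Finset.univ.filter fun x => x ≠ 0 ∧ ¬ Γ.Adj v (e x)
  let D : Finset (ZMod p) := Finset.univ.filter fun x => Γ.Adj v (e x)
  have hU : ∀ x, x ∈ U ↔ x ≠ 0 ∧ ¬ Γ.Adj v (e x) := by simp [U]
  have hD : ∀ x, x ∈ D ↔ Γ.Adj v (e x) := by simp [D]
  have hD0 : (0 : ZMod p) ∉ D := by simp [hD, he0]
  have hU0 : (0 : ZMod p) ∉ U := by simp [hU]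
  have hsub : ∀ x y, x - y ∈ U ↔ (e x : V) ≠ e y ∧ ¬ Γ.Adj (e x) (e y) := fun x y => by
    rw [hU, Γ.adj_comm (e x), he, Ne, Ne, heinj, sub_eq_zero]
  have hmemD : ∀ x, x ∈ D ↔ x ≠ 0 ∧ x ∉ U := fun x => by
    by_cases hx : x = 0
    · simp [hx, hD0]
    · simp [hU, hD, hx]
  have hgeo : ∀ x, x ∈ U → Is2Geodesic Γ v u (e x) := fun x hx => by
    refine ⟨hvu, hue x, ?_, ((hU x).mp hx).2⟩
    rw [← he0, Ne, heinj]
    exact ((hU x).mp hx).1.symm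
  have hgeo' : ∀ y, Is2Geodesic Γ v u y → ∃ x ∈ U, (e x : V) = y := by
    rintro y ⟨-, huy, hne, hadj⟩
    obtain ⟨x, rfl⟩ := hex y huy
    refine ⟨x, (hU x).mpr ⟨?_, hadj⟩, rfl⟩
    rintro rfl
    exact hne he0.symm
  obtain ⟨x₀, hx₀, rfl⟩ := hgeo' w hg
  have hDne : D.Nonempty := by
    obtain ⟨x, rfl⟩ := hex t hut
    exact ⟨x, (hD x).mpr hvt⟩
  have hneg : ∀ x ∈ U, -x ∈ U := fun x hx => by
    rw [← zero_sub, hsub, ne_comm, Γ.adj_comm, ← hsub, sub_zero]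
    exact hx
  have hmul : ∀ x ∈ U, ∀ y ∈ U, ∃ a, a * x = y ∧ ∀ z ∈ U, a * z ∈ U := by
    intro x hx y hy
    obtain ⟨φ, hφv, hφu, hφx⟩ := h2gt.2 (hgeo x hx) (hgeo y hy)
    obtain ⟨σ, hσ⟩ := SimpleGraph.exists_perm_neighborSet φ hφu
    have hσe : ∀ i, (e (e.symm (σ (e i))) : V) = φ (e i) := fun i => by
      rw [Equiv.apply_symm_apply, hσ]
    have hπ : ∀ i j, i - j ∈ U → e.symm (σ (e i)) - e.symm (σ (e j)) ∈ U := by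
      intro i j hij
      rw [hsub] at hij ⊢
      rwa [hσe, hσe, φ.injective.ne_iff, φ.map_adj_iff]
    obtain ⟨d, hd⟩ := hDne
    obtain ⟨a, b, hab⟩ := ZMod.exists_affine_of_preserves_differences U hU0 ⟨x, hx⟩
      ⟨d, (hmemD d).mp hd⟩ (fun i => e.symm (σ (e i)))
      ((e.symm.injective.comp σ.injective).comp e.injective) hπ
    have hb : b = 0 := by
      have h0 := hab 0
      rw [mul_zero, zero_add] at h0
      rw [← h0, ← heinj, hσe, he0, hφv]
    subst hb
    simp only [add_zero] at hab
    refine ⟨a, ?_, fun z hz => ?_⟩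
    · rw [← hab, ← heinj, hσe, hφx]
    · rw [← hab, ← sub_zero (e.symm (σ (e z)))]
      have h0 := hab 0
      rw [mul_zero] at h0
      have := hπ z 0 (by rwa [sub_zero])
      rwa [h0] at this
  have hcount := h2gt.card_mul_eq hg
  set c := Nat.card {x | Γ.Adj v x ∧ Γ.Adj x (e x₀)} with hc
  have hcU : ∀ x ∈ U, Nat.card {y | Γ.Adj v y ∧ Γ.Adj y (e x)} = c := by
    intro x hx
    obtain ⟨φ, hφv, -, hφx⟩ := h2gt.2 (hgeo x hx) hg
    refine Nat.card_congr (φ.toEquiv.subtypeEquiv fun y => ?_)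
    change _ ↔ Γ.Adj v (φ y) ∧ Γ.Adj (φ y) (e x₀)
    rw [← hφx, φ.map_adj_iff]
    nth_rewrite 2 [← hφv]
    rw [φ.map_adj_iff]
    rfl
  have hk : Nat.card {y | Γ.dist v y = 2 ∧ Γ.Adj u y} = U.card := by
    rw [← Fintype.card_coe, ← Nat.card_eq_fintype_card]
    refine (Nat.card_congr (Equiv.ofBijective (fun x : U =>
      (⟨e x, SimpleGraph.dist_eq_two_iff.mpr ⟨(hgeo x x.2).2.2.1, (hgeo x x.2).2.2.2,
        u, hvu, hue x⟩, hue x⟩ : {y | Γ.dist v y = 2 ∧ Γ.Adj u y})) ⟨?_, ?_⟩)).symm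
    · intro x y hxy
      exact Subtype.ext ((heinj _ _).mp (Subtype.mk.inj hxy))
    · rintro ⟨y, hy, huy⟩
      obtain ⟨hne, hadj, -⟩ := SimpleGraph.dist_eq_two_iff.mp hy
      obtain ⟨x, hx, rfl⟩ := hgeo' y ⟨hvu, huy, hne, hadj⟩
      exact ⟨⟨x, hx⟩, rfl⟩
  have hlt : ∀ x ∈ U, (D.filter (fun y => y - x ∈ D)).card < c := by
    intro x hx
    rw [← hcU x hx, Nat.card_eq_fintype_card, Fintype.card_subtype]
    have himg : ((D.filter (fun y => y - x ∈ D)).image (fun y => (e y : V))).card =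
        (D.filter (fun y => y - x ∈ D)).card :=
      Finset.card_image_of_injective _ fun y z h => (heinj y z).mp h
    rw [← himg]
    refine Finset.card_lt_card ((Finset.ssubset_iff_of_subset ?_).mpr ⟨u, ?_, ?_⟩)
    · intro y hy
      obtain ⟨z, hz, rfl⟩ := Finset.mem_image.mp hy
      rw [Finset.mem_filter, hD, hD, ← he, Γ.adj_comm (e x)] at hz
      simpa using hz
    · simpa using ⟨hvu, hue x⟩
    · intro h
      obtain ⟨z, -, hz⟩ := Finset.mem_image.mp h
      exact (hue z).ne hz.symm
  have hcle : c ≤ p := by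
    rw [← hreg v]
    exact Nat.card_mono (Set.toFinite _) fun x hx => hx.1
  have hcp : c ≠ p := by
    intro hcp
    have hall : {x | Γ.Adj v x ∧ Γ.Adj x (e x₀)} = Γ.neighborSet v := by
      refine Set.eq_of_subset_of_ncard_le (fun x hx => hx.1) ?_ (Set.toFinite _)
      rw [← Nat.card_coe_set_eq, ← Nat.card_coe_set_eq, hreg, ← hc]
      exact hcp.ge
    have hshift : ∀ x, x ∈ D → x - x₀ ∈ D := by
      intro x hx
      rw [hD] at hx
      have hx' : (e x : V) ∈ {x | Γ.Adj v x ∧ Γ.Adj x (e x₀)} := hall ▸ hx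
      rw [hD, ← he]
      exact hx'.2.symm
    obtain ⟨d, hd⟩ := hDne
    have hiter : ∀ n : ℕ, d - n * x₀ ∈ D := by
      intro n
      induction n with
      | zero => simpa using hd
      | succ n ih =>
        have := hshift _ ih
        rwa [sub_sub, ← add_one_mul, ← Nat.cast_add_one] at this
    obtain ⟨n, hn⟩ := ZMod.natCast_zmod_surjective (d * x₀⁻¹)
    have := hiter n
    rw [hn, inv_mul_cancel_right₀ ((hU x₀).mp hx₀).1, sub_self] at this
    exact hD0 this
  have hcpos : 0 < c := (Nat.zero_le _).trans_lt (hlt x₀ hx₀)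
  rw [hreg, hk] at hcount
  have hdvd : c ∣ U.card := by
    refine Nat.Coprime.dvd_of_dvd_mul_left (m := p) ?_ (hcount ▸ dvd_mul_left _ _)
    exact (Nat.coprime_of_lt_prime hcpos.ne' (lt_of_le_of_ne hcle hcp) hp).symm
  have hcU' := ZMod.card_eq_of_dvd_card_of_lt U D hU0 ⟨x₀, hx₀⟩ hDne hmemD hneg hmul c hdvd hlt
  rw [← hcU'] at hcount
  exact (Nat.eq_of_mul_eq_mul_right hcpos hcount).symm
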